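/- Let 1 ≤ p, q < ∞ and suppose (X, 𝒜, μ|_𝒜) has the finite subset property and is not purely atomic, so that X decomposes as X = (∪_{i∈ℕ} A_i) ∪ B with {A_i} pairwise disjoint 𝒜-atoms and B a non-atomic 𝒜-set of positive measure. If the restriction of the bounded WCE operator T = M_w E M_u : L^p(X, Σ, μ) → L^q(X, Σ, μ) to the non-atomic part B is a non-zero operator, then T is not nuclear. -/

import Mathlib

open MeasureTheory ENNReal Filter
open scoped ENNReal

noncomputable section

/-- A bounded linear operator `T : E → F` is **nuclear** if it admits a representation
`T x = ∑ₙ φₙ(x) • yₙ` with `∑ₙ ‖φₙ‖ ‖yₙ‖ < ∞`. -/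
def IsNuclearOperator {E F : Type*} [NormedAddCommGroup E] [NormedSpace ℝ E]
    [NormedAddCommGroup F] [NormedSpace ℝ F] (T : E →L[ℝ] F) : Prop :=
  ∃ (φ : ℕ → (E →L[ℝ] ℝ)) (y : ℕ → F),
    Summable (fun n => ‖φ n‖ * ‖y n‖) ∧ ∀ x : E, HasSum (fun n => (φ n x) • y n) (T x)

/-- `A` is an atom of `μ` relative to the σ-algebra `m` : `A` is `m`-measurable with
`μ A > 0`, and every `m`-measurable subset of `A` has measure `0` or `μ A`. -/
def IsMeasAtom {X : Type*} {m0 : MeasurableSpace X} (m : MeasurableSpace X)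
    (μ : @MeasureTheory.Measure X m0) (A : Set X) : Prop :=
  MeasurableSet[m] A ∧ 0 < μ A ∧
    ∀ F : Set X, MeasurableSet[m] F → F ⊆ A → μ F = 0 ∨ μ F = μ A

/-- `B` contains no `m`-atom of positive measure. -/
def NonAtomicSet {X : Type*} {m0 : MeasurableSpace X} (m : MeasurableSpace X)
    (μ : @MeasureTheory.Measure X m0) (B : Set X) : Prop :=
  ∀ A : Set X, A ⊆ B → ¬ IsMeasAtom m μ A

theorem IsNuclearOperator.isCompactOperator {E F : Type*} [NormedAddCommGroup E]
    [NormedSpace ℝ E] [NormedAddCommGroup F] [NormedSpace ℝ F] [CompleteSpace F]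
    {T : E →L[ℝ] F} (hT : IsNuclearOperator T) : IsCompactOperator T := by
  obtain ⟨φ, y, hsum, hrep⟩ := hT
  have hS : Summable fun n => (φ n).smulRight (y n) :=
    .of_norm (by simpa only [ContinuousLinearMap.norm_smulRight_apply] using hsum)
  have hlim : HasSum (fun n => (φ n).smulRight (y n)) T := by
    convert hS.hasSum
    ext x
    have h := (ContinuousLinearMap.apply ℝ F x).hasSum hS.hasSum
    exact (hrep x).unique h
  refine isCompactOperator_of_tendsto hlim (Eventually.of_forall fun s => ?_)
  exact (compactOperator (RingHom.id ℝ) E F).sum_mem fun n _ =>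
    (isCompactOperator_of_locallyCompactSpace_dom (φ n)).continuous_comp
      (g := fun c : ℝ => c • y n) (by fun_prop)

/-- In a finite measure without atoms inside `P`, the set `P` can be split into two measurable
pieces, each carrying at least a third of the mass. -/
theorem exists_measurable_third_split {X : Type*} [MeasurableSpace X] (ν : Measure X)
    [IsFiniteMeasure ν] {P : Set X} (hP : MeasurableSet P)
    (hna : ∀ Q, MeasurableSet Q → Q ⊆ P → ν Q ≠ 0 →
      ∃ F, MeasurableSet F ∧ F ⊆ Q ∧ ν F ≠ 0 ∧ ν (Q \ F) ≠ 0) :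
    ∃ F, MeasurableSet F ∧ F ⊆ P ∧ ν.real P ≤ 3 * ν.real F ∧ ν.real P ≤ 3 * ν.real (P \ F) := by
  by_contra! hcon
  have hdiff : ∀ {Q F : Set X}, MeasurableSet F → F ⊆ Q →
      ν.real (Q \ F) = ν.real Q - ν.real F := fun hF hFQ => measureReal_sdiff hFQ hF
  have hdich : ∀ F, MeasurableSet F → F ⊆ P → 3 * ν.real F ≤ ν.real P →
      3 * ν.real F < ν.real P := fun F hF hFP h => by
    by_contra! h'
    have := hcon F hF hFP h'
    rw [hdiff hF hFP] at this
    have := measureReal_nonneg (μ := ν) (s := P)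
    linarith
  have hdich2 : ∀ F, MeasurableSet F → F ⊆ P → 3 * ν.real F ≤ 2 * ν.real P →
      3 * ν.real F < ν.real P := fun F hF hFP h => by
    by_contra! h'
    have := hcon F hF hFP h'
    rw [hdiff hF hFP] at this
    linarith
  have hPpos : 0 < ν.real P := by
    by_contra! h
    have := hcon ∅ .empty (Set.empty_subset _) (by simpa using h)
    rw [Set.sdiff_empty] at this
    linarith [measureReal_nonneg (μ := ν) (s := P)]
  let small : Set (Set X) := {F | MeasurableSet F ∧ F ⊆ P ∧ 3 * ν.real F < ν.real P}
  have hempty : ∅ ∈ small := ⟨.empty, Set.empty_subset _, by simpa using hPpos⟩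
  have hunion : ∀ F ∈ small, ∀ G ∈ small, F ∪ G ∈ small := fun F hF G hG => by
    refine ⟨hF.1.union hG.1, Set.union_subset hF.2.1 hG.2.1,
      hdich2 _ (hF.1.union hG.1) (Set.union_subset hF.2.1 hG.2.1) ?_⟩
    have := measureReal_union_le (μ := ν) F G
    linarith [hF.2.2, hG.2.2]
  have hbdd : BddAbove (ν.real '' small) := ⟨ν.real P, by
    rintro _ ⟨F, hF, rfl⟩
    exact measureReal_mono hF.2.1⟩
  obtain ⟨v, -, hvlim, hvmem⟩ :=
    exists_seq_tendsto_sSup (Set.Nonempty.image ν.real ⟨∅, hempty⟩) hbdd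
  choose F hFs hFv using hvmem
  have hacc : ∀ n, Set.accumulate F n ∈ small := fun n => by
    induction n with
    | zero => simpa using hFs 0
    | succ n ih => rw [Set.accumulate_succ]; exact hunion _ ih _ (hFs _)
  have hVlim : Tendsto (fun n => ν.real (Set.accumulate F n)) atTop (nhds (ν.real (⋃ n, F n))) :=
    (tendsto_toReal_iff (fun _ ↦ measure_ne_top _ _) (measure_ne_top _ _)).2
      tendsto_measure_iUnion_accumulate
  have hVm : MeasurableSet (⋃ n, F n) := .iUnion fun n => (hFs n).1
  have hVP : (⋃ n, F n) ⊆ P := Set.iUnion_subset fun n => (hFs n).2.1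
  have hV : (⋃ n, F n) ∈ small := ⟨hVm, hVP, hdich _ hVm hVP
    (le_of_tendsto (hVlim.const_mul 3) (Eventually.of_forall fun n => (hacc n).2.2.le))⟩
  have hsup : sSup (ν.real '' small) ≤ ν.real (⋃ n, F n) :=
    le_of_tendsto hvlim (Eventually.of_forall fun n => by
      rw [← hFv n]; exact measureReal_mono (Set.subset_iUnion F n))
  set V := ⋃ n, F n
  have hextend : ∀ G, MeasurableSet G → G ⊆ P \ V → ν G ≠ 0 → G ∉ small :=
    fun G hG hGV hG0 hGs => by
    have hle := (le_csSup hbdd ⟨_, hunion _ hV _ hGs, rfl⟩).trans hsup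
    rw [measureReal_union (Set.disjoint_sdiff_right.mono_right hGV) hG] at hle
    have : 0 < ν.real G := ENNReal.toReal_pos hG0 (measure_ne_top _ _)
    linarith
  have hR : ν.real (P \ V) = ν.real P - ν.real V := hdiff hVm hVP
  have hR0 : ν (P \ V) ≠ 0 := fun h => by
    have : ν.real (P \ V) = 0 := by simp [Measure.real, h]
    linarith [hV.2.2]
  obtain ⟨G, hG, hGR, hG0, hG1⟩ := hna _ (hP.diff hVm) Set.sdiff_subset hR0
  have hle : ν.real G + ν.real ((P \ V) \ G) ≤ ν.real P := by
    rw [hdiff hG hGR]; linarith [measureReal_nonneg (μ := ν) (s := V)]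
  have hGP : G ⊆ P := hGR.trans Set.sdiff_subset
  have hG'P : (P \ V) \ G ⊆ P := Set.sdiff_subset.trans Set.sdiff_subset
  have hG'm : MeasurableSet ((P \ V) \ G) := (hP.diff hVm).diff hG
  rcases le_total (ν.real G) (ν.real ((P \ V) \ G)) with h | h
  · exact hextend G hG hGR hG0 ⟨hG, hGP, hdich2 G hG hGP (by linarith)⟩
  · exact hextend _ hG'm Set.sdiff_subset hG1 ⟨hG'm, hG'P, hdich2 _ hG'm hG'P (by linarith)⟩

/-- In a finite measure without atoms inside `P`, some measurable subset of `P` is far, for the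
measure of the symmetric difference, from each of finitely many given sets. -/
theorem exists_measurable_far_from_finset {X : Type*} [MeasurableSpace X] (ν : Measure X)
    [IsFiniteMeasure ν] {ι : Type*} (I : Finset ι) (S : ι → Set X)
    (hS : ∀ i, MeasurableSet (S i)) {P : Set X} (hP : MeasurableSet P)
    (hna : ∀ Q, MeasurableSet Q → Q ⊆ P → ν Q ≠ 0 →
      ∃ F, MeasurableSet F ∧ F ⊆ Q ∧ ν F ≠ 0 ∧ ν (Q \ F) ≠ 0) :
    ∃ F, MeasurableSet F ∧ F ⊆ P ∧ ν.real P ≤ 3 * ν.real F ∧ ν.real P ≤ 3 * ν.real (P \ F) ∧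
      ∀ i ∈ I, ν.real P ≤ 3 * ν.real (P ∩ symmDiff F (S i)) := by
  classical
  induction I using Finset.induction_on generalizing P with
  | empty =>
    obtain ⟨F, h₁, h₂, h₃, h₄⟩ := exists_measurable_third_split ν hP hna
    exact ⟨F, h₁, h₂, h₃, h₄, by simp⟩
  | insert j I hj ih =>
    obtain ⟨F, hF, hFP, hF₁, hF₂, hFI⟩ := ih (hP.inter (hS j))
      fun Q hQ hQP => hna Q hQ (hQP.trans Set.inter_subset_left)
    obtain ⟨G, hG, hGP, hG₁, hG₂, hGI⟩ := ih (hP.diff (hS j))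
      fun Q hQ hQP => hna Q hQ (hQP.trans Set.sdiff_subset)
    have hsplit : ∀ Q : Set X, ν.real Q = ν.real (Q ∩ S j) + ν.real (Q \ S j) := fun Q =>
      (measureReal_inter_add_sdiff (hS j)).symm
    have hFj : ∀ x ∈ F, x ∈ P ∧ x ∈ S j := fun x hx => hFP hx
    have hGj : ∀ x ∈ G, x ∈ P ∧ x ∉ S j := fun x hx => hGP hx
    refine ⟨F ∪ G, hF.union hG, Set.union_subset (hFP.trans Set.inter_subset_left)
      (hGP.trans Set.sdiff_subset), ?_, ?_, ?_⟩
    · have h₁ : (F ∪ G) ∩ S j = F := by ext x; have := hFj x; have := hGj x; simp; tauto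
      have h₂ : (F ∪ G) \ S j = G := by ext x; have := hFj x; have := hGj x; simp; tauto
      rw [hsplit P, hsplit (F ∪ G), h₁, h₂]
      linarith
    · have h₁ : (P \ (F ∪ G)) ∩ S j = (P ∩ S j) \ F := by
        ext x; have := hFj x; have := hGj x; simp; tauto
      have h₂ : (P \ (F ∪ G)) \ S j = (P \ S j) \ G := by
        ext x; have := hFj x; have := hGj x; simp; tauto
      rw [hsplit P, hsplit (P \ (F ∪ G)), h₁, h₂]
      linarith
    · intro i hi
      rcases Finset.mem_insert.1 hi with rfl | hi
      · have h₁ : (P ∩ symmDiff (F ∪ G) (S i)) ∩ S i = (P ∩ S i) \ F := by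
          ext x; have := hFj x; have := hGj x; simp [Set.mem_symmDiff]; tauto
        have h₂ : (P ∩ symmDiff (F ∪ G) (S i)) \ S i = G := by
          ext x; have := hFj x; have := hGj x; simp [Set.mem_symmDiff]; tauto
        rw [hsplit P, hsplit (P ∩ symmDiff (F ∪ G) (S i)), h₁, h₂]
        linarith
      · have h₁ : (P ∩ symmDiff (F ∪ G) (S i)) ∩ S j = (P ∩ S j) ∩ symmDiff F (S i) := by
          ext x; have := hFj x; have := hGj x; simp [Set.mem_symmDiff]; tauto
        have h₂ : (P ∩ symmDiff (F ∪ G) (S i)) \ S j = (P \ S j) ∩ symmDiff G (S i) := by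
          ext x; have := hFj x; have := hGj x; simp [Set.mem_symmDiff]; tauto
        rw [hsplit P, hsplit (P ∩ symmDiff (F ∪ G) (S i)), h₁, h₂]
        linarith [hFI i hi, hGI i hi]

/-- Absolute continuity transfers non-atomicity. -/
theorem NonAtomicSet.exists_split_of_absolutelyContinuous {X : Type*} [m : MeasurableSpace X]
    {μ ν : Measure X} [SigmaFinite μ] [IsFiniteMeasure ν] (hνμ : ν ≪ μ) {Q : Set X}
    (hQna : NonAtomicSet m μ Q) (hQ : MeasurableSet Q) (hQ0 : ν Q ≠ 0) :
    ∃ F, MeasurableSet F ∧ F ⊆ Q ∧ ν F ≠ 0 ∧ ν (Q \ F) ≠ 0 := by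
  have hd : Measurable (ν.rnDeriv μ) := Measure.measurable_rnDeriv ν μ
  have hpos : ∀ R, ν R = 0 ↔ μ ({x | ν.rnDeriv μ x ≠ 0} ∩ R) = 0 := fun R => by
    conv_lhs => rw [← Measure.withDensity_rnDeriv_eq ν μ hνμ]
    exact withDensity_apply_eq_zero hd
  have hsupp : MeasurableSet {x | ν.rnDeriv μ x ≠ 0} := hd (measurableSet_singleton 0).compl
  set D := {x | ν.rnDeriv μ x ≠ 0}
  have hna := hQna (D ∩ Q) Set.inter_subset_right
  simp only [IsMeasAtom, not_and, not_forall, not_or] at hna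
  obtain ⟨F, hF, hFQ, hF0, hF1⟩ := hna (hsupp.inter hQ) (pos_iff_ne_zero.2 ((hpos Q).not.1 hQ0))
  refine ⟨F, hF, hFQ.trans Set.inter_subset_right, ?_, ?_⟩
  · rw [Ne, hpos, Set.inter_eq_self_of_subset_right (hFQ.trans Set.inter_subset_left)]
    exact hF0
  · rw [Ne, hpos, ← Set.inter_sdiff_assoc]
    intro h
    exact hF1 (le_antisymm (measure_mono hFQ) (measure_mono_ae (ae_le_set.2 h)))

/-- A bounded weighted conditional expectation operator which does not vanish on a set without
atoms of the conditioning σ-algebra is not compact. -/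
theorem not_isCompactOperator_of_nonzero_on_nonAtomicSet {X : Type*} (m : MeasurableSpace X)
    {m0 : MeasurableSpace X} (μ : Measure X) (hm : m ≤ m0) [SigmaFinite (μ.trim hm)]
    (p q : ℝ≥0∞) [Fact (1 ≤ p)] [Fact (1 ≤ q)] (hq : q ≠ ∞) {B : Set X}
    (hBm : MeasurableSet[m] B) (hBna : NonAtomicSet m μ B) (w u : X → ℝ)
    (T : Lp ℝ p μ →L[ℝ] Lp ℝ q μ)
    (hT : ∀ f : Lp ℝ p μ, ⇑(T f) =ᵐ[μ] fun x => w x * (μ[fun y => u y * f y | m]) x)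
    {f : Lp ℝ p μ} (hfB : ¬ ∀ᵐ x ∂μ, x ∈ B → T f x = 0) :
    ¬ IsCompactOperator T := by
  intro hcomp
  have hq0 : q ≠ 0 := (zero_lt_one.trans_le (Fact.out : 1 ≤ q)).ne'
  have hqpos : 0 < q.toReal := ENNReal.toReal_pos hq0 hq
  have hint : Integrable (fun y => u y * f y) μ := by
    by_contra hni
    refine hfB ?_
    filter_upwards [hT f] with x hx _
    rw [hx, condExp_of_not_integrable hni]
    simp
  let g := T f
  -- the mass distribution of `|g|^q`
  let ν : Measure X := μ.withDensity fun x => ‖g x‖ₑ ^ q.toReal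
  have hgm : Measurable fun x => ‖g x‖ₑ ^ q.toReal :=
    ((Lp.stronglyMeasurable g).measurable.enorm).pow_const _
  have hνfin : IsFiniteMeasure ν := isFiniteMeasure_withDensity
    (lintegral_rpow_enorm_lt_top_of_eLpNorm_lt_top hq0 hq (Lp.eLpNorm_lt_top g)).ne
  have hνμ : ν.trim hm ≪ μ.trim hm := (withDensity_absolutelyContinuous _ _).trim hm
  have hνB : ν B ≠ 0 := by
    rw [Ne, withDensity_apply_eq_zero hgm]
    intro h
    refine hfB ?_
    filter_upwards [measure_eq_zero_iff_ae_notMem.1 h] with x hx hxB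
    by_contra hgx
    exact hx ⟨by simpa [hqpos.le, hqpos] using hgx, hxB⟩
  have hBna' : NonAtomicSet m (μ.trim hm) B := by
    intro C hCB hC
    refine hBna C hCB ⟨hC.1, ?_, fun F hF hFC => ?_⟩
    · simpa only [trim_measurableSet_eq hm hC.1] using hC.2.1
    · simpa only [trim_measurableSet_eq hm hC.1, trim_measurableSet_eq hm hF] using hC.2.2 F hF hFC
  -- localizations of `f` to the sets of `m`
  let r : {S : Set X // MeasurableSet[m] S} → Lp ℝ p μ := fun S =>
    ((Lp.memLp f).indicator (hm _ S.2)).toLp _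
  have hr : ∀ S, r S =ᵐ[μ] (S : Set X).indicator f := fun S => MemLp.coeFn_toLp _
  have hrnorm : ∀ S, ‖r S‖ ≤ ‖f‖ := fun S => by
    refine Lp.norm_le_norm_of_ae_le ?_
    filter_upwards [hr S] with x hx
    rw [hx]
    exact norm_indicator_le_norm_self _ _
  have hTr : ∀ S, T (r S) =ᵐ[μ] (S : Set X).indicator g := fun S => by
    have h₁ : (fun y => u y * r S y) =ᵐ[μ] (S : Set X).indicator fun y => u y * f y := by
      filter_upwards [hr S] with x hx
      rw [hx]
      by_cases hxS : x ∈ (S : Set X) <;> simp [hxS]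
    filter_upwards [hT (r S), hT f, condExp_congr_ae (m := m) h₁, condExp_indicator hint S.2]
      with x hx hx' h h'
    rw [hx, h, h']
    by_cases hxS : x ∈ (S : Set X) <;> simp [hxS, g, hx']
  have hdist : ∀ S S' : {S : Set X // MeasurableSet[m] S},
      ν.real (symmDiff (S : Set X) S') = dist (T (r S)) (T (r S')) ^ q.toReal := fun S S' => by
    have hsm : MeasurableSet (symmDiff (S : Set X) S') := (hm _ S.2).symmDiff (hm _ S'.2)
    rw [dist_eq_norm, Lp.norm_def, eLpNorm_eq_lintegral_rpow_enorm_toReal hq0 hq,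
      ← ENNReal.toReal_rpow, ← Real.rpow_mul ENNReal.toReal_nonneg, one_div_mul_cancel hqpos.ne',
      Real.rpow_one, Measure.real, withDensity_apply _ hsm, ← lintegral_indicator hsm]
    congr 1
    refine lintegral_congr_ae ?_
    filter_upwards [hTr S, hTr S', Lp.coeFn_sub (T (r S)) (T (r S'))] with x h₁ h₂ h₃
    rw [h₃, Pi.sub_apply, h₁, h₂]
    by_cases hx : x ∈ (S : Set X) <;> by_cases hx' : x ∈ (S' : Set X) <;>
      simp [hx, hx', Set.mem_symmDiff, hqpos]
  have htb : TotallyBounded (Set.range fun S => T (r S)) := by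
    refine (hcomp.isCompact_closure_image_closedBall (f := (T : Lp ℝ p μ →ₗ[ℝ] Lp ℝ q μ))
      ‖f‖).totallyBounded.subset (subset_trans ?_ subset_closure)
    rintro _ ⟨S, rfl⟩
    exact ⟨r S, by simpa using hrnorm S, rfl⟩
  have hνB' : 0 < ν.real B := ENNReal.toReal_pos hνB (measure_ne_top _ _)
  let ε : ℝ := (ν.real B / 3) ^ q.toReal⁻¹
  have hε : 0 < ε := by positivity
  obtain ⟨t, htr, htfin, hcover⟩ := Metric.finite_approx_of_totallyBounded htb ε hε
  lift t to Finset (Lp ℝ q μ) using htfin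
  classical
  rw [← Set.image_univ] at htr
  obtain ⟨I, -, rfl⟩ := Finset.subset_set_image_iff.1 htr
  have hreal : ∀ S, MeasurableSet[m] S → (ν.trim hm).real S = ν.real S := fun S hS => by
    simp only [Measure.real, trim_measurableSet_eq hm hS]
  obtain ⟨F, hF, -, -, -, hfar⟩ := @exists_measurable_far_from_finset X m (ν.trim hm) _ _ I
    (fun S => S) (fun S => S.2) B hBm fun Q hQ hQB hQ0 =>
      NonAtomicSet.exists_split_of_absolutelyContinuous (m := m) hνμ
        (fun C hC => hBna' C (hC.trans hQB)) hQ hQ0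
  obtain ⟨_, hy, hball⟩ := Set.mem_iUnion₂.1 (hcover ⟨⟨F, hF⟩, rfl⟩)
  obtain ⟨S, hSI, rfl⟩ := Finset.mem_image.1 (Finset.mem_coe.1 hy)
  have h₁ := hfar S hSI
  rw [hreal _ hBm, hreal _ (hBm.inter (hF.symmDiff S.2))] at h₁
  have h₂ : ν.real (B ∩ symmDiff F S) ≤ ν.real (symmDiff F S) :=
    measureReal_mono Set.inter_subset_right
  have h₃ := Real.rpow_lt_rpow dist_nonneg (Metric.mem_ball.1 hball) hqpos
  rw [← hdist ⟨F, hF⟩ S, ← Real.rpow_mul (by positivity), inv_mul_cancel₀ hqpos.ne',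
    Real.rpow_one] at h₃
  linarith

/-- If `(X, 𝒜, μ|𝒜)` has the finite subset property and is not purely
atomic, `X = (⋃ i, A i) ∪ B` with `A i` pairwise disjoint `𝒜`-atoms and `B` a non-atomic
`𝒜`-set of positive measure, and the restriction of the bounded WCE operator
`T = M_w E M_u : L^p(μ) → L^q(μ)` to `B` is non-zero, then `T` is not nuclear. -/
theorem WCE_not_nuclear_of_nonzero_on_nonatomic_part
    {X : Type*} [m0 : MeasurableSpace X] (μ : Measure X) [μ.IsComplete] [SigmaFinite μ]
    (m : MeasurableSpace X) (hm : m ≤ m0) [SigmaFinite (μ.trim hm)]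
    (p q : ℝ≥0∞) [Fact (1 ≤ p)] [Fact (1 ≤ q)] (hp : p ≠ ∞) (hq : q ≠ ∞)
    -- finite subset property of `(X, 𝒜, μ|𝒜)` :
    (hFS : ∀ S : Set X, MeasurableSet[m] S → 0 < μ S →
      ∃ F : Set X, MeasurableSet[m] F ∧ F ⊆ S ∧ 0 < μ F ∧ μ F < ∞)
    -- decomposition into atoms and a non-atomic part of positive measure :
    (A : ℕ → Set X) (B : Set X)
    (hA : ∀ i, IsMeasAtom m μ (A i)) (hdisj : Pairwise (Function.onFun Disjoint A))
    (hBm : MeasurableSet[m] B) (hBdisj : ∀ i, Disjoint (A i) B)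
    (hBna : NonAtomicSet m μ B) (hBpos : 0 < μ B)
    (hX : (⋃ i, A i) ∪ B = Set.univ)
    (w u : X → ℝ) (hw : Measurable w) (hu : Measurable u)
    (T : Lp ℝ p μ →L[ℝ] Lp ℝ q μ)
    (hT : ∀ f : Lp ℝ p μ, ⇑(T f) =ᵐ[μ] fun x => w x * (μ[fun y => u y * f y | m]) x)
    -- the restriction of `T` to the non-atomic part `B` is a non-zero operator :
    (hTB : ∃ f : Lp ℝ p μ, (∀ᵐ x ∂μ, x ∉ B → f x = 0) ∧
      ¬ (∀ᵐ x ∂μ, x ∈ B → T f x = 0)) :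
    ¬ IsNuclearOperator T := by
  obtain ⟨f, -, hfB⟩ := hTB
  exact fun hnuc => not_isCompactOperator_of_nonzero_on_nonAtomicSet m μ hm p q hq hBm hBna w u
    T hT hfB hnuc.isCompactOperator
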